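/- arXiv:2305.14329 — 2 statements merged into one kernel-verified Lean document; each statement's English description precedes it below -/
import Mathlib

section
/- Let Γ be a finite-horizon zero-sum polymatrix Markov game. Then: (i) the program P_NE is feasible; (ii) every feasible point (π, w) of P_NE has objective value Σ_{k ∈ [n]} ( w_{k,1}(s₁) − V^π_{k,1}(s₁) ) = Σ_{k ∈ [n]} w_{k,1}(s₁) ≥ 0; and (iii) the global minimum value of P_NE equals 0, attained by taking π to be a Nash equilibrium product policy of Γ and w_{k,h}(s) = V^{†,π_{−k}}_{k,h}(s). -/
open Finset

section FiniteHorizon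

variable {n : ℕ} {S : Type*} [Fintype S] {A : Fin n → Type*}
  [∀ k, Fintype (A k)] [∀ k, DecidableEq (A k)]

/-- `f` is a probability distribution on the finite type `α`. -/
def IsDist {α : Type*} [Fintype α] (f : α → ℝ) : Prop :=
  (∀ x, 0 ≤ f x) ∧ ∑ x, f x = 1

/-- A (nonstationary) Markov policy over horizon `H`: a distribution on `α`
for every timestep `h < H` (`h` is 0-indexed) and state `s`. -/
def IsPol {S : Type*} {α : Type*} [Fintype α] (H : ℕ) (π : ℕ → S → α → ℝ) : Prop :=
  ∀ h, h < H → ∀ s : S, IsDist (π h s)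

/-- A valid transition kernel over horizon `H`. -/
def IsKernel (H : ℕ) (P : ℕ → S → (∀ k, A k) → S → ℝ) : Prop :=
  ∀ h, h < H → ∀ s a, IsDist (P h s a)

/-- Rewards take values in `[-1, 1]`. -/
def IsReward (H : ℕ) (r : Fin n → ℕ → S → (∀ k, A k) → ℝ) : Prop :=
  ∀ k, ∀ h, h < H → ∀ s a, r k h s a ∈ Set.Icc (-1 : ℝ) 1

/-- Value with `t` remaining steps, current timestep `h` (0-indexed), state `s`,
under joint (possibly correlated) policy `σ`, reward function `rk` and kernel `P`. -/
noncomputable def valAux (P : ℕ → S → (∀ k, A k) → S → ℝ)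
    (rk : ℕ → S → (∀ k, A k) → ℝ) (σ : ℕ → S → (∀ k, A k) → ℝ) :
    ℕ → ℕ → S → ℝ
  | 0, _, _ => 0
  | t + 1, h, s =>
      ∑ a, σ h s a * (rk h s a + ∑ s', P h s a s' * valAux P rk σ t (h + 1) s')

/-- `val H P rk σ h s` is the expected total reward `V^σ_{h}(s)` accumulated from
timestep `h` (0-indexed; the paper's `h+1`) up to the horizon `H`. -/
noncomputable def val (H : ℕ) (P : ℕ → S → (∀ k, A k) → S → ℝ)
    (rk : ℕ → S → (∀ k, A k) → ℝ) (σ : ℕ → S → (∀ k, A k) → ℝ)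
    (h : ℕ) (s : S) : ℝ :=
  valAux P rk σ (H - h) h s

/-- The joint policy in which player `k` plays `π'` independently against the
marginal `σ₋ₖ` of the joint policy `σ`. -/
noncomputable def deviate (k : Fin n) (π' : ℕ → S → A k → ℝ)
    (σ : ℕ → S → (∀ j, A j) → ℝ) : ℕ → S → (∀ j, A j) → ℝ :=
  fun h s a => π' h s (a k) * ∑ b : A k, σ h s (Function.update a k b)

/-- The marginal policy of player `k` induced by a joint policy `σ`. -/
noncomputable def marginal (σ : ℕ → S → (∀ j, A j) → ℝ) (k : Fin n) :
    ℕ → S → A k → ℝ :=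
  fun h s b => ∑ a : ∀ j, A j, if a k = b then σ h s a else 0

/-- The product policy induced by individual policies `π k`. -/
def prodPol (π : ∀ k, ℕ → S → A k → ℝ) : ℕ → S → (∀ j, A j) → ℝ :=
  fun h s a => ∏ k, π k h s (a k)

/-- `σ` is an `ε`-approximate coarse correlated equilibrium:
no unilateral (Markov-policy) deviation gains more than `ε`. -/
def IsCCE (H : ℕ) (P : ℕ → S → (∀ k, A k) → S → ℝ)
    (r : Fin n → ℕ → S → (∀ k, A k) → ℝ) (s₁ : S) (ε : ℝ)
    (σ : ℕ → S → (∀ k, A k) → ℝ) : Prop :=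
  ∀ k : Fin n, ∀ π' : ℕ → S → A k → ℝ, IsPol H π' →
    val H P (r k) (deviate k π' σ) 0 s₁ - val H P (r k) σ 0 s₁ ≤ ε

/-- The product policy `π` is an `ε`-approximate Nash equilibrium. -/
def IsNE (H : ℕ) (P : ℕ → S → (∀ k, A k) → S → ℝ)
    (r : Fin n → ℕ → S → (∀ k, A k) → ℝ) (s₁ : S) (ε : ℝ)
    (π : ∀ k, ℕ → S → A k → ℝ) : Prop :=
  ∀ k : Fin n, ∀ π' : ℕ → S → A k → ℝ, IsPol H π' →
    val H P (r k) (deviate k π' (prodPol π)) 0 s₁ -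
      val H P (r k) (prodPol π) 0 s₁ ≤ ε

/-- `v` is the best-response value `V^{†,σ₋ₖ}_{k,h}(s)` of player `k` against the
joint policy `σ` from timestep `h` and state `s`. -/
def IsBRVal (H : ℕ) (P : ℕ → S → (∀ k, A k) → S → ℝ)
    (rk : ℕ → S → (∀ k, A k) → ℝ) (σ : ℕ → S → (∀ k, A k) → ℝ)
    (k : Fin n) (h : ℕ) (s : S) (v : ℝ) : Prop :=
  IsGreatest {x : ℝ | ∃ π' : ℕ → S → A k → ℝ, IsPol H π' ∧
    x = val H P rk (deviate k π' σ) h s} v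

/-- The game is zero-sum polymatrix: rewards sum to zero at every state and
joint action, and each player's reward decomposes into pairwise payoffs
(each valued in `[-1, 1]`) with the other players. -/
def IsZSPolymatrix (H : ℕ) (r : Fin n → ℕ → S → (∀ k, A k) → ℝ) : Prop :=
  (∀ h, h < H → ∀ s a, ∑ k, r k h s a = 0) ∧
  ∃ q : (k : Fin n) → (j : Fin n) → ℕ → S → A k → A j → ℝ,
    (∀ k j h s x y, q k j h s x y ∈ Set.Icc (-1 : ℝ) 1) ∧
    ∀ k, ∀ h, h < H → ∀ s a,
      r k h s a = ∑ j ∈ univ.filter (fun j => j ≠ k), q k j h s (a k) (a j)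

/-- Switching control: at every state a single player (possibly depending on
the state) controls the transition. -/
def SwitchingControl (H : ℕ) (P : ℕ → S → (∀ k, A k) → S → ℝ) : Prop :=
  ∀ s : S, ∃ k : Fin n, ∀ h, h < H → ∀ a a' : ∀ j, A j, a k = a' k → P h s a = P h s a'

/-- Feasibility for the nonlinear program `P_NE` (with the terminal condition
`w k H s = 0`, 0-indexed timesteps). -/
def FeasNE (H : ℕ) (P : ℕ → S → (∀ k, A k) → S → ℝ)
    (r : Fin n → ℕ → S → (∀ k, A k) → ℝ)
    (π : ∀ k, ℕ → S → A k → ℝ) (w : Fin n → ℕ → S → ℝ) : Prop :=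
  (∀ k, IsPol H (π k)) ∧ (∀ k s, w k H s = 0) ∧
  ∀ k : Fin n, ∀ h, h < H → ∀ s, ∀ b : A k,
    (∑ a : ∀ j, A j, if a k = b then
        (∏ j ∈ univ.filter (fun j => j ≠ k), π j h s (a j)) *
          (r k h s a + ∑ s', P h s a s' * w k (h + 1) s')
      else 0) ≤ w k h s

/-- Objective of the nonlinear program `P_NE`. -/
noncomputable def objNE (H : ℕ) (P : ℕ → S → (∀ k, A k) → S → ℝ)
    (r : Fin n → ℕ → S → (∀ k, A k) → ℝ) (s₁ : S)
    (π : ∀ k, ℕ → S → A k → ℝ) (w : Fin n → ℕ → S → ℝ) : ℝ :=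
  ∑ k, (w k 0 s₁ - val H P (r k) (prodPol π) 0 s₁)

/-- Feasibility for the best-response linear program `P_BR(σ̂)`. -/
def FeasBR (H : ℕ) (P : ℕ → S → (∀ k, A k) → S → ℝ)
    (r : Fin n → ℕ → S → (∀ k, A k) → ℝ)
    (σ' : ℕ → S → (∀ k, A k) → ℝ) (w : Fin n → ℕ → S → ℝ) : Prop :=
  (∀ k s, w k H s = 0) ∧
  ∀ k : Fin n, ∀ h, h < H → ∀ s, ∀ b : A k,
    (∑ a : ∀ j, A j, if a k = b then
        (∑ b' : A k, σ' h s (Function.update a k b')) *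
          (r k h s a + ∑ s', P h s a s' * w k (h + 1) s')
      else 0) ≤ w k h s

/-- Objective of the best-response linear program `P_BR(σ̂)`. -/
noncomputable def objBR (H : ℕ) (P : ℕ → S → (∀ k, A k) → S → ℝ)
    (r : Fin n → ℕ → S → (∀ k, A k) → ℝ) (s₁ : S)
    (σ' : ℕ → S → (∀ k, A k) → ℝ) (w : Fin n → ℕ → S → ℝ) : ℝ :=
  ∑ k, (w k 0 s₁ - val H P (r k) σ' 0 s₁)

end FiniteHorizon

section Brouwer

open Metric MeasureTheory

variable {E : Type*} [NormedAddCommGroup E] [InnerProductSpace ℝ E] [FiniteDimensional ℝ E]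

/-- The determinant of `id + t • B` is polynomial in `t`; hence its value at `1` is a fixed affine
combination of its values at sufficiently many nodes. -/
theorem exists_affine_combination_det (ε : ℝ) (hε : 0 < ε) :
    ∃ (N : ℕ) (t c : ℕ → ℝ), (∀ i ∈ range N, 0 < t i ∧ t i < ε) ∧ ∑ i ∈ range N, c i = 1 ∧
      ∀ B : E →ₗ[ℝ] E, LinearMap.det (LinearMap.id + B) =
        ∑ i ∈ range N, c i * LinearMap.det (LinearMap.id + t i • B) := by
  let d := Module.finrank ℝ E
  let t : ℕ → ℝ := fun i => ε / (i + 2)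
  have ht : Set.InjOn t (range (d + 1)) := by
    intro i _ j _ hij
    simp only [t] at hij
    have hi : (0 : ℝ) < i + 2 := by positivity
    have hj : (0 : ℝ) < j + 2 := by positivity
    rw [div_eq_div_iff hi.ne' hj.ne'] at hij
    have := mul_left_cancel₀ hε.ne' hij
    have h : (j : ℝ) = i := by linarith
    exact_mod_cast h.symm
  refine ⟨d + 1, t, fun i => (Lagrange.basis (range (d + 1)) t i).eval 1, ?_, ?_, ?_⟩
  · intro i _
    refine ⟨by positivity, ?_⟩
    rw [div_lt_iff₀ (by positivity)]
    have : (0 : ℝ) ≤ i := by positivity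
    nlinarith
  · rw [← Polynomial.eval_finsetSum, Lagrange.sum_basis ht ⟨0, by simp⟩, Polynomial.eval_one]
  · intro B
    let b := Module.finBasis ℝ E
    let M := LinearMap.toMatrix b b B
    let p : Polynomial ℝ := Matrix.det ((Polynomial.X : Polynomial ℝ) • M.map Polynomial.C +
      (1 : Matrix (Fin d) (Fin d) ℝ).map Polynomial.C)
    have hp : ∀ s : ℝ, p.eval s = LinearMap.det (LinearMap.id + s • B) := by
      intro s
      rw [← LinearMap.det_toMatrix b, ← Polynomial.coe_evalRingHom, RingHom.map_det]
      congr 1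
      ext i j
      simp only [RingHom.mapMatrix_apply, Matrix.map_apply, Matrix.add_apply, Matrix.smul_apply,
        map_add, map_smul, LinearMap.toMatrix_id, smul_eq_mul, Polynomial.eval_mul, M,
        Polynomial.coe_evalRingHom, Polynomial.eval_X, Polynomial.eval_C]
      ring
    have hdeg : p.degree < #(range (d + 1)) := by
      refine lt_of_le_of_lt Polynomial.degree_le_natDegree ?_
      have := Polynomial.natDegree_det_X_add_C_le M 1
      rw [Fintype.card_fin] at this
      rw [card_range]
      exact_mod_cast Nat.lt_succ_of_le this
    have h1 := congrArg (Polynomial.eval 1) (Lagrange.eq_interpolate ht hdeg)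
    rw [Lagrange.interpolate_apply, Polynomial.eval_finsetSum, hp, one_smul] at h1
    rw [h1]
    refine sum_congr rfl fun i _ => ?_
    rw [Polynomial.eval_mul, Polynomial.eval_C, hp, mul_comm]

theorem det_id_add_pos (B : E →L[ℝ] E) {t : ℝ} (ht : 0 ≤ t) {L : ℝ} (hB : ‖B‖ ≤ L)
    (htL : t * L < 1) : 0 < LinearMap.det (LinearMap.id + t • (B : E →ₗ[ℝ] E)) := by
  have hne : ∀ s ∈ Set.Icc 0 t, LinearMap.det (LinearMap.id + s • (B : E →ₗ[ℝ] E)) ≠ 0 := by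
    intro s hs h0
    obtain ⟨v, hv, hv0⟩ := Submodule.exists_mem_ne_zero_of_ne_bot
      (LinearMap.bot_lt_ker_of_det_eq_zero h0).ne'
    have hv' : v = -(s • B v) := by
      have : v + s • B v = 0 := by simpa using hv
      exact eq_neg_of_add_eq_zero_left this
    have h1 : ‖v‖ ≤ s * (L * ‖v‖) := by
      conv_lhs => rw [hv', norm_neg, norm_smul, Real.norm_of_nonneg hs.1]
      exact mul_le_mul_of_nonneg_left (B.le_of_opNorm_le hB v) hs.1
    have h2 : 0 < ‖v‖ := norm_pos_iff.2 hv0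
    have h3 : 0 ≤ L := (norm_nonneg _).trans hB
    nlinarith [mul_le_mul_of_nonneg_right hs.2 h3]
  have hcont : Continuous fun s : ℝ => LinearMap.det (LinearMap.id + s • (B : E →ₗ[ℝ] E)) := by
    have : Continuous fun s : ℝ => (ContinuousLinearMap.id ℝ E + s • B).det :=
      ContinuousLinearMap.continuous_det.comp (by fun_prop)
    simpa [ContinuousLinearMap.det] using this
  by_contra hneg
  push Not at hneg
  obtain ⟨s, hs, hs0⟩ := intermediate_value_Icc' ht hcont.continuousOn
    (⟨hneg, by simp⟩ : (0 : ℝ) ∈ Set.Icc _ _)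
  exact hne s hs hs0

theorem image_ball_of_small_perturbation {ρ : ℝ} {R : E → E}
    (hsph : ∀ x, ‖x‖ = ρ → R x = x) (hnorm : ∀ x, ‖x‖ ≤ ρ → ‖R x‖ = ρ)
    {L : NNReal} (hL : LipschitzOnWith L (fun x => R x - x) (closedBall 0 ρ))
    {t : ℝ} (ht0 : 0 < t) (ht1 : t < 1) (htL : t * L < 1) (hρ : 0 < ρ) :
    Set.InjOn (fun x => x + t • (R x - x)) (ball 0 ρ) ∧
      (fun x => x + t • (R x - x)) '' ball 0 ρ = ball 0 ρ := by
  set F : E → E := fun x => x + t • (R x - x) with hF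
  have happ : ApproximatesLinearOn F (ContinuousLinearEquiv.refl ℝ E : E →L[ℝ] E)
      (closedBall 0 ρ) (t.toNNReal * L) := by
    intro x hx y hy
    have h : F x - F y - (ContinuousLinearEquiv.refl ℝ E : E →L[ℝ] E) (x - y)
        = t • ((R x - x) - (R y - y)) := by
      simp only [hF, ContinuousLinearEquiv.coe_refl, ContinuousLinearMap.id_apply, smul_sub]
      abel
    rw [h, norm_smul, Real.norm_of_nonneg ht0.le, NNReal.coe_mul, Real.coe_toNNReal _ ht0.le,
      mul_assoc]
    exact mul_le_mul_of_nonneg_left (hL.norm_sub_le hx hy) ht0.le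
  have hc : Subsingleton E ∨
      t.toNNReal * L < ‖((ContinuousLinearEquiv.refl ℝ E).symm : E →L[ℝ] E)‖₊⁻¹ := by
    rcases subsingleton_or_nontrivial E with h | h
    · exact Or.inl h
    · right
      have : ‖((ContinuousLinearEquiv.refl ℝ E).symm : E →L[ℝ] E)‖₊ = 1 := by
        ext; simp
      rw [this, inv_one, ← NNReal.coe_lt_coe]
      simpa [ht0.le] using htL
  have hsub : F '' ball 0 ρ ⊆ ball 0 ρ := by
    rintro _ ⟨x, hx, rfl⟩
    rw [mem_ball_zero_iff] at hx ⊢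
    have h : F x = (1 - t) • x + t • R x := by
      simp only [hF, smul_sub, sub_smul, one_smul]; abel
    rw [h]
    calc ‖(1 - t) • x + t • R x‖ ≤ (1 - t) * ‖x‖ + t * ‖R x‖ := by
          refine (norm_add_le _ _).trans ?_
          rw [norm_smul, norm_smul, Real.norm_of_nonneg ht0.le,
            Real.norm_of_nonneg (sub_nonneg.2 ht1.le)]
      _ < ρ := by rw [hnorm x hx.le]; nlinarith
  have hopen : IsOpen (F '' ball 0 ρ) :=
    (happ.mono_set ball_subset_closedBall).open_image
      (ContinuousLinearEquiv.refl ℝ E).toNonlinearRightInverse isOpen_ball hc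
  refine ⟨(happ.injOn hc).mono ball_subset_closedBall, hsub.antisymm ?_⟩
  refine (convex_ball (0 : E) ρ).isPreconnected.subset_of_closure_inter_subset hopen
    ⟨F 0, hsub ⟨0, by simpa using hρ, rfl⟩, ⟨0, by simpa using hρ, rfl⟩⟩ ?_
  rintro y ⟨hy, hyb⟩
  have hcl : IsClosed (F '' closedBall 0 ρ) :=
    ((isCompact_closedBall 0 ρ).image_of_continuousOn happ.continuousOn).isClosed
  obtain ⟨x, hx, rfl⟩ := closure_minimal (Set.image_mono ball_subset_closedBall) hcl hy
  rw [mem_closedBall_zero_iff] at hx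
  rcases hx.lt_or_eq with h | h
  · exact ⟨x, by simpa using h, rfl⟩
  · have : F x = x := by simp [hF, hsph x h]
    rw [this, mem_ball_zero_iff] at hyb
    exact absurd h hyb.ne

/-- No-retraction theorem: there is no `C¹` map that fixes a sphere and
sends the ball it bounds into the sphere. -/
theorem no_contDiff_retraction {ρ : ℝ} (hρ : 0 < ρ) {R : E → E} (hR : ContDiff ℝ 1 R)
    (hsph : ∀ x, ‖x‖ = ρ → R x = x) (hnorm : ∀ x, ‖x‖ ≤ ρ → ‖R x‖ = ρ) : False := by
  let : MeasurableSpace E := borel E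
  have : BorelSpace E := ⟨rfl⟩
  let g : E → E := fun x => R x - x
  have hg : ContDiff ℝ 1 g := hR.sub contDiff_id
  have hdg : Continuous (fderiv ℝ g) := hg.continuous_fderiv one_ne_zero
  obtain ⟨L, hL⟩ := (isCompact_closedBall (0 : E) ρ).exists_bound_of_continuousOn
    hdg.continuousOn
  have hL0 : 0 ≤ L := (norm_nonneg _).trans (hL 0 (by simpa using hρ.le))
  have hLip : LipschitzOnWith L.toNNReal g (closedBall 0 ρ) :=
    (convex_closedBall 0 ρ).lipschitzOnWith_of_nnnorm_fderiv_le
      (fun x _ => hg.differentiable one_ne_zero x)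
      (fun x hx => by
        rw [← NNReal.coe_le_coe, Real.coe_toNNReal _ hL0]; exact hL x hx)
  obtain ⟨N, t, c, ht, hc, hdet⟩ :=
    exists_affine_combination_det (E := E) (1 / (L + 1)) (by positivity)
  let D : ℝ → E → ℝ := fun s x => (ContinuousLinearMap.id ℝ E + s • fderiv ℝ g x).det
  have hDcont : ∀ s, Continuous (D s) := fun s =>
    ContinuousLinearMap.continuous_det.comp (by fun_prop)
  have hDint : ∀ s, IntegrableOn (D s) (ball 0 ρ) := fun s =>
    ((hDcont s).continuousOn.integrableOn_compact (isCompact_closedBall 0 ρ)).mono_set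
      ball_subset_closedBall
  have hvol : ∀ i ∈ range N, ∫ x in ball (0 : E) ρ, D (t i) x = volume.real (ball (0 : E) ρ) := by
    intro i hi
    obtain ⟨h0, h1⟩ := ht i hi
    rw [lt_div_iff₀ (by positivity)] at h1
    have htL : t i * L < 1 := by nlinarith
    have ht1 : t i < 1 := by nlinarith [mul_nonneg h0.le hL0]
    obtain ⟨hinj, himg⟩ := image_ball_of_small_perturbation hsph hnorm hLip h0 ht1
      (by rwa [Real.coe_toNNReal _ hL0]) hρ
    have hder : ∀ x ∈ ball (0 : E) ρ, HasFDerivWithinAt (fun x => x + t i • (R x - x))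
        (ContinuousLinearMap.id ℝ E + t i • fderiv ℝ g x) (ball 0 ρ) x := fun x _ =>
      ((hasFDerivAt_id x).add
        (((hg.differentiable one_ne_zero x).hasFDerivAt).const_smul (t i))).hasFDerivWithinAt
    have h := integral_image_eq_integral_abs_det_fderiv_smul volume measurableSet_ball hder hinj
      (fun _ => (1 : ℝ))
    rw [himg] at h
    simp only [integral_const, smul_eq_mul, mul_one, measureReal_restrict_apply_univ] at h
    rw [h]
    refine setIntegral_congr_fun measurableSet_ball fun x hx => ?_
    have hpos := det_id_add_pos (fderiv ℝ g x) h0.le (hL x (ball_subset_closedBall hx)) htL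
    exact (abs_of_pos (a := D (t i) x) hpos).symm
  have hD1 : ∀ x ∈ ball (0 : E) ρ, D 1 x = 0 := by
    intro x hx
    have hfd : ContinuousLinearMap.id ℝ E + (1 : ℝ) • fderiv ℝ g x = fderiv ℝ R x := by
      have : fderiv ℝ g x = fderiv ℝ R x - ContinuousLinearMap.id ℝ E :=
        ((hR.differentiable one_ne_zero x).hasFDerivAt.sub (hasFDerivAt_id x)).fderiv
      rw [this, one_smul]; abel
    have horth : ∀ v, inner ℝ (R x) (fderiv ℝ R x v) = 0 := by
      intro v
      have h1 := ((hR.differentiable one_ne_zero x).hasFDerivAt.norm_sq)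
      have h2 : HasFDerivAt (fun y => ‖R y‖ ^ 2) (0 : E →L[ℝ] ℝ) x := by
        refine (hasFDerivAt_const (ρ ^ 2) x).congr_of_eventuallyEq ?_
        filter_upwards [isOpen_ball.mem_nhds hx] with y hy
        rw [hnorm y (by simpa using (mem_ball_zero_iff.1 hy).le)]
      have h3 := congrArg (fun T => T v) (h1.unique h2)
      simpa using h3
    by_contra hne
    have hne' : LinearMap.det (fderiv ℝ R x : E →ₗ[ℝ] E) ≠ 0 := by
      rw [← hfd]; exact hne
    have hsurj := (LinearMap.equivOfDetNeZero _ hne').surjective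
    obtain ⟨v, hv⟩ := hsurj (R x)
    have hv' : fderiv ℝ R x v = R x := hv
    have h4 := horth v
    rw [hv', real_inner_self_eq_norm_sq, hnorm x (mem_ball_zero_iff.1 hx).le] at h4
    exact hρ.ne' (pow_eq_zero_iff two_ne_zero |>.1 h4)
  have hfinal : ∫ x in ball (0 : E) ρ, D 1 x = volume.real (ball (0 : E) ρ) := by
    have h1 : ∀ x, D 1 x = ∑ i ∈ range N, c i * D (t i) x := by
      intro x
      have := hdet (fderiv ℝ g x : E →ₗ[ℝ] E)
      simpa [D, ContinuousLinearMap.det] using this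
    simp_rw [h1]
    rw [integral_finsetSum _ fun i _ => (hDint (t i)).const_mul (c i)]
    simp_rw [integral_const_mul]
    rw [sum_congr rfl fun i hi => by rw [hvol i hi], ← sum_mul, hc, one_mul]
  rw [setIntegral_congr_fun measurableSet_ball hD1, integral_zero] at hfinal
  exact (ENNReal.toReal_pos (measure_ball_pos volume (0 : E) hρ).ne' measure_ball_lt_top.ne).ne
    hfinal

/-- Brouwer's fixed point theorem, for bounded continuous self-maps of a Euclidean space. -/
theorem exists_fixedPoint_of_bounded {f : E → E} (hf : Continuous f) {M : ℝ}
    (hM : ∀ x, ‖f x‖ ≤ M) : ∃ x, f x = x := by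
  by_contra! hfix
  have hM0 : 0 ≤ M := (norm_nonneg _).trans (hM 0)
  obtain ⟨q, hq, hqf, -⟩ := hf.exists_contDiff_approx 1
    (ε := fun x => min 1 ‖f x - x‖) (by fun_prop)
    (fun x => lt_min one_pos (norm_pos_iff.2 (sub_ne_zero.2 (hfix x))))
  have hqfix : ∀ x, q x ≠ x := by
    intro x hx
    have := (hqf x).trans_le (min_le_right _ _)
    rw [hx, dist_comm, dist_eq_norm] at this
    exact lt_irrefl _ this
  have hqM : ∀ x, ‖q x‖ ≤ M + 1 := by
    intro x
    have h1 := (hqf x).trans_le (min_le_left _ _)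
    rw [dist_eq_norm] at h1
    have h2 : ‖q x‖ ≤ ‖q x - f x‖ + ‖f x‖ := by simpa using norm_add_le (q x - f x) (f x)
    linarith [hM x]
  let χ : ContDiffBump (0 : E) := ⟨M + 2, M + 3, by linarith, by linarith⟩
  let G : E → E := fun x => x - χ x • q x
  have hG : ContDiff ℝ 1 G := contDiff_id.sub (χ.contDiff.smul hq)
  have hG0 : ∀ x, G x ≠ 0 := by
    intro x hx
    have hx' : x = χ x • q x := sub_eq_zero.1 hx
    have hle : ‖x‖ ≤ M + 1 := by
      rw [hx', norm_smul, Real.norm_of_nonneg χ.nonneg]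
      exact (mul_le_of_le_one_left (norm_nonneg _) χ.le_one).trans (hqM x)
    have h1 : χ x = 1 := χ.one_of_mem_closedBall (by
      rw [mem_closedBall_zero_iff]; change ‖x‖ ≤ M + 2; linarith)
    rw [h1, one_smul] at hx'
    exact hqfix x hx'.symm
  have hρ : 0 < M + 3 := by linarith
  refine no_contDiff_retraction hρ (R := fun x => ((M + 3) * ‖G x‖⁻¹) • G x) ?_ ?_ ?_
  · exact (contDiff_const.mul ((hG.norm ℝ hG0).inv fun x => (norm_pos_iff.2 (hG0 x)).ne')).smul hG
  · intro x hx
    have h0 : χ x = 0 := χ.zero_of_le_dist (by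
      rw [dist_zero_right, hx])
    have hGx : G x = x := by simp [G, h0]
    simp only [hGx, hx]
    rw [mul_inv_cancel₀ hρ.ne', one_smul]
  · intro x _
    have := norm_pos_iff.2 (hG0 x)
    rw [norm_smul, norm_mul, norm_inv, norm_norm, Real.norm_of_nonneg hρ.le]
    field_simp

end Brouwer

section SimplexFixedPoint

variable {ι : Type*} [Fintype ι] {A : ι → Type*} [∀ k, Fintype (A k)]

/-- A retraction of `α → ℝ` onto the standard simplex. -/
noncomputable def simplexRetract {α : Type*} [Fintype α] (y : α → ℝ) (b : α) : ℝ :=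
  (max (y b) 0 + max (1 - ∑ c, max (y c) 0) 0 / Fintype.card α) / max 1 (∑ c, max (y c) 0)

theorem continuous_simplexRetract {α : Type*} [Fintype α] :
    Continuous (simplexRetract : (α → ℝ) → α → ℝ) := by
  unfold simplexRetract
  refine continuous_pi fun b => Continuous.div (by fun_prop) (by fun_prop) fun y => ?_
  exact (zero_lt_one.trans_le (le_max_left _ _)).ne'

theorem isDist_simplexRetract {α : Type*} [Fintype α] [Nonempty α] (y : α → ℝ) :
    IsDist (simplexRetract y) := by
  have hpos : 0 < max 1 (∑ c, max (y c) 0) := zero_lt_one.trans_le (le_max_left _ _)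
  refine ⟨fun b => by unfold simplexRetract; positivity, ?_⟩
  simp only [simplexRetract]
  rw [← sum_div, sum_add_distrib, sum_const, card_univ, nsmul_eq_mul,
    mul_div_cancel₀ _ (by exact_mod_cast Fintype.card_ne_zero), div_eq_one_iff_eq hpos.ne']
  rcases le_total (∑ c, max (y c) 0) 1 with h | h
  · rw [max_eq_left h, max_eq_left (by linarith)]; ring
  · rw [max_eq_right h, max_eq_right (by linarith)]; ring

theorem simplexRetract_of_isDist {α : Type*} [Fintype α] {y : α → ℝ} (hy : IsDist y) :
    simplexRetract y = y := by
  funext b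
  have h : ∀ c, max (y c) 0 = y c := fun c => max_eq_left (hy.1 c)
  simp [simplexRetract, h, hy.2]

theorem IsDist.le_one {α : Type*} [Fintype α] {y : α → ℝ} (hy : IsDist y) (b : α) : y b ≤ 1 :=
  hy.2 ▸ single_le_sum (fun c _ => hy.1 c) (mem_univ b)

/-- Brouwer's fixed point theorem on a product of simplices. -/
theorem exists_fixedPoint_of_isDist [∀ k, Nonempty (A k)]
    {T : (∀ k, A k → ℝ) → ∀ k, A k → ℝ}
    (hT : ContinuousOn T {x | ∀ k, IsDist (x k)})
    (hmaps : ∀ x, (∀ k, IsDist (x k)) → ∀ k, IsDist (T x k)) :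
    ∃ x, (∀ k, IsDist (x k)) ∧ T x = x := by
  let ret : EuclideanSpace ℝ (Σ k, A k) → ∀ k, A k → ℝ :=
    fun y k => simplexRetract fun b => y ⟨k, b⟩
  have hret : Continuous ret :=
    continuous_pi fun k => continuous_simplexRetract.comp (by fun_prop)
  have hretd : ∀ y k, IsDist (ret y k) := fun y k => isDist_simplexRetract _
  have hTret : Continuous fun y => T (ret y) := hT.comp_continuous hret hretd
  let f : EuclideanSpace ℝ (Σ k, A k) → EuclideanSpace ℝ (Σ k, A k) :=
    fun y => WithLp.toLp 2 fun p => T (ret y) p.1 p.2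
  have hf : Continuous f := by
    refine (PiLp.continuous_toLp 2 _).comp (continuous_pi fun p => ?_)
    exact (continuous_apply p.2).comp ((continuous_apply p.1).comp hTret)
  have hbound : ∀ y, ‖f y‖ ≤ √(Fintype.card (Σ k, A k)) := by
    intro y
    rw [EuclideanSpace.norm_eq]
    refine Real.sqrt_le_sqrt ?_
    rw [← card_univ, ← nsmul_one]
    refine sum_le_card_nsmul _ _ _ fun p _ => ?_
    have hd := hmaps _ (hretd y) p.1
    rw [Real.norm_of_nonneg (hd.1 p.2)]
    exact pow_le_one₀ (hd.1 p.2) (hd.le_one p.2)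
  obtain ⟨y, hy⟩ := exists_fixedPoint_of_bounded hf hbound
  have hcoord : ∀ k b, y ⟨k, b⟩ = T (ret y) k b := fun k b => by
    conv_lhs => rw [← hy]
  refine ⟨ret y, hretd y, ?_⟩
  funext k
  have h1 : (fun b => y ⟨k, b⟩) = T (ret y) k := funext (hcoord k)
  change T (ret y) k = simplexRetract fun b => y ⟨k, b⟩
  rw [h1, simplexRetract_of_isDist (hmaps _ (hretd y) k)]

end SimplexFixedPoint

section NormalForm

variable {n : ℕ} {A : Fin n → Type*} [∀ k, Fintype (A k)] [∀ k, DecidableEq (A k)]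

/-- Expected payoff of the mixed profile `x` when the payoff function is `u`. -/
noncomputable def mixedPayoff (u : (∀ k, A k) → ℝ) (x : ∀ k, A k → ℝ) : ℝ :=
  ∑ a, (∏ j, x j (a j)) * u a

/-- Expected payoff under `u` when player `k` plays `b` and the others follow `x`. -/
noncomputable def purePayoff (u : (∀ k, A k) → ℝ) (x : ∀ k, A k → ℝ) (k : Fin n) (b : A k) : ℝ :=
  ∑ a : ∀ j, A j, if a k = b then (∏ j ∈ univ.filter (fun j => j ≠ k), x j (a j)) * u a else 0

theorem mixedPayoff_eq_sum_purePayoff (u : (∀ k, A k) → ℝ) (x : ∀ k, A k → ℝ) (k : Fin n) :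
    mixedPayoff u x = ∑ b, x k b * purePayoff u x k b := by
  simp only [mixedPayoff, purePayoff, mul_sum]
  rw [sum_comm]
  refine sum_congr rfl fun a _ => ?_
  simp only [mul_ite, mul_zero, sum_ite_eq, mem_univ, if_true]
  rw [filter_ne', ← mul_assoc, mul_prod_erase univ (fun j => x j (a j)) (mem_univ k)]

theorem purePayoff_congr (u : (∀ k, A k) → ℝ) {x y : ∀ k, A k → ℝ} {k : Fin n}
    (h : ∀ j, j ≠ k → x j = y j) (b : A k) : purePayoff u x k b = purePayoff u y k b := by
  unfold purePayoff
  refine sum_congr rfl fun a _ => ?_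
  rw [prod_congr rfl fun j hj => by rw [h j (mem_filter.1 hj).2]]

/-- Nash's theorem: every finite normal-form game has a mixed equilibrium. -/
theorem exists_mixed_nash [∀ k, Nonempty (A k)] (u : Fin n → (∀ k, A k) → ℝ) :
    ∃ x : ∀ k, A k → ℝ, (∀ k, IsDist (x k)) ∧
      ∀ k b, purePayoff (u k) x k b ≤ mixedPayoff (u k) x := by
  let g : (∀ k, A k → ℝ) → ∀ k, A k → ℝ :=
    fun x k b => max (purePayoff (u k) x k b - mixedPayoff (u k) x) 0
  have hg0 : ∀ x k b, 0 ≤ g x k b := fun x k b => le_max_right _ _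
  have hgs : ∀ x k, 0 ≤ ∑ b, g x k b := fun x k => sum_nonneg fun b _ => hg0 x k b
  have hgc : ∀ k b, Continuous fun x => g x k b := by
    intro k b
    have h1 : Continuous fun x => purePayoff (u k) x k b := by
      unfold purePayoff
      refine continuous_finsetSum _ fun a _ => ?_
      split_ifs <;> fun_prop
    have h2 : Continuous fun x => mixedPayoff (u k) x := by
      unfold mixedPayoff; fun_prop
    exact (h1.sub h2).max continuous_const
  let T : (∀ k, A k → ℝ) → ∀ k, A k → ℝ :=
    fun x k b => (x k b + g x k b) / (1 + ∑ c, g x k c)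
  have hden : ∀ x k, 0 < 1 + ∑ c, g x k c := fun x k => by linarith [hgs x k]
  have hT : Continuous T := by
    refine continuous_pi fun k => continuous_pi fun b => Continuous.div ?_ ?_ fun x =>
      (hden x k).ne'
    · have hxc : Continuous fun x : ∀ k, A k → ℝ => x k b := by fun_prop
      exact hxc.add (hgc k b)
    · exact continuous_const.add (continuous_finsetSum _ fun c _ => hgc k c)
  have hmaps : ∀ x, (∀ k, IsDist (x k)) → ∀ k, IsDist (T x k) := by
    intro x hx k
    refine ⟨fun b => div_nonneg (add_nonneg ((hx k).1 b) (hg0 x k b)) (hden x k).le, ?_⟩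
    rw [← sum_div, sum_add_distrib, (hx k).2, div_self (hden x k).ne']
  obtain ⟨x, hx, hfix⟩ := exists_fixedPoint_of_isDist hT.continuousOn hmaps
  refine ⟨x, hx, fun k b => ?_⟩
  have hmul : ∀ c, x k c * ∑ c, g x k c = g x k c := by
    intro c
    have h1 : (x k c + g x k c) / (1 + ∑ c, g x k c) = x k c := congrFun (congrFun hfix k) c
    rw [div_eq_iff (hden x k).ne'] at h1
    linarith
  have hex : ∃ c, 0 < x k c ∧ g x k c = 0 := by
    by_contra! hno
    have hlt : ∀ c, 0 < x k c → mixedPayoff (u k) x < purePayoff (u k) x k c := by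
      intro c hc
      by_contra hle
      exact hno c hc (max_eq_right (by linarith))
    obtain ⟨c, -, hc⟩ : ∃ c ∈ univ, 0 < x k c := by
      refine exists_lt_of_sum_lt (s := univ) (f := fun _ => (0 : ℝ)) ?_
      rw [(hx k).2]; simp
    have h2 : ∑ c, x k c * mixedPayoff (u k) x < ∑ c, x k c * purePayoff (u k) x k c := by
      refine sum_lt_sum (fun d _ => ?_) ⟨c, mem_univ c, mul_lt_mul_of_pos_left (hlt c hc) hc⟩
      rcases ((hx k).1 d).eq_or_lt with h | h
      · rw [← h]; simp
      · exact (mul_lt_mul_of_pos_left (hlt d h) h).le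
    rw [← sum_mul, (hx k).2, one_mul, ← mixedPayoff_eq_sum_purePayoff] at h2
    exact lt_irrefl _ h2
  obtain ⟨c, hc, hgc0⟩ := hex
  have hsum : ∑ c, g x k c = 0 := by
    have := hmul c
    rw [hgc0] at this
    exact (mul_eq_zero.1 this).resolve_left hc.ne'
  have hgb : g x k b = 0 := by rw [← hmul b, hsum, mul_zero]
  have := le_max_left (purePayoff (u k) x k b - mixedPayoff (u k) x) 0
  change _ ≤ g x k b at this
  linarith

end NormalForm

section MarkovGame

variable {n : ℕ} {S : Type*} {A : Fin n → Type*} [∀ k, Fintype (A k)]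
  {H : ℕ} {P : ℕ → S → (∀ k, A k) → S → ℝ} {r : Fin n → ℕ → S → (∀ k, A k) → ℝ}

theorem deviate_prodPol {π : ∀ k, ℕ → S → A k → ℝ} {k : Fin n} (hπ : IsPol H (π k))
    (π' : ℕ → S → A k → ℝ) (h : ℕ) (hh : h < H) (s : S) (a : ∀ k, A k) :
    deviate k π' (prodPol π) h s a = prodPol (Function.update π k π') h s a := by
  unfold deviate prodPol
  have h1 : ∀ b : A k, ∏ j, π j h s (Function.update a k b j) =
      π k h s b * ∏ j ∈ univ.erase k, π j h s (a j) := by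
    intro b
    rw [← mul_prod_erase univ _ (mem_univ k), Function.update_self]
    congr 1
    exact prod_congr rfl fun j hj => by rw [Function.update_of_ne (ne_of_mem_erase hj)]
  simp only [h1]
  rw [← sum_mul, (hπ h hh s).2, one_mul,
    ← mul_prod_erase univ (fun j => Function.update π k π' j h s (a j)) (mem_univ k),
    Function.update_self]
  congr 1
  exact prod_congr rfl fun j hj => by rw [Function.update_of_ne (ne_of_mem_erase hj)]

variable [Fintype S]

/-- The payoff of the one-shot game at a state, given continuation values `W`. -/
noncomputable def stagePayoff (P : ℕ → S → (∀ k, A k) → S → ℝ)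
    (rk : ℕ → S → (∀ k, A k) → ℝ) (h : ℕ) (W : S → ℝ) (s : S) (a : ∀ k, A k) : ℝ :=
  rk h s a + ∑ s', P h s a s' * W s'

theorem valAux_congr (rk : ℕ → S → (∀ k, A k) → ℝ) {σ τ : ℕ → S → (∀ k, A k) → ℝ}
    (hστ : ∀ h, h < H → ∀ s a, σ h s a = τ h s a) (t h : ℕ) (ht : h + t ≤ H) (s : S) :
    valAux P rk σ t h s = valAux P rk τ t h s := by
  induction t generalizing h s with
  | zero => rfl
  | succ t ih =>
    simp only [valAux, hστ h (by omega), fun s' => ih (h + 1) (by omega) s']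

theorem sum_valAux_eq_zero (hz : ∀ h, h < H → ∀ s a, ∑ k, r k h s a = 0)
    (σ : ℕ → S → (∀ k, A k) → ℝ) (t h : ℕ) (ht : h + t ≤ H) (s : S) :
    ∑ k, valAux P (r k) σ t h s = 0 := by
  induction t generalizing h s with
  | zero => simp [valAux]
  | succ t ih =>
    simp only [valAux]
    rw [sum_comm]
    refine sum_eq_zero fun a _ => ?_
    rw [← mul_sum, sum_add_distrib, hz h (by omega), sum_comm]
    simp only [← mul_sum, fun s' => ih (h + 1) (by omega) s', mul_zero, sum_const_zero, add_zero]

theorem val_deviate_prodPol {π : ∀ k, ℕ → S → A k → ℝ} {k : Fin n} (hπ : IsPol H (π k))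
    (π' : ℕ → S → A k → ℝ) (rk : ℕ → S → (∀ k, A k) → ℝ) {h : ℕ} (hh : h ≤ H) (s : S) :
    val H P rk (deviate k π' (prodPol π)) h s =
      val H P rk (prodPol (Function.update π k π')) h s :=
  valAux_congr rk (deviate_prodPol hπ π') _ _ (by omega) s

variable [∀ k, DecidableEq (A k)]

/-- At a feasible point of `P_NE`, `w` dominates the value of every unilateral deviation. -/
theorem FeasNE.val_update_le (hP : IsKernel H P) {π : ∀ k, ℕ → S → A k → ℝ}
    {w : Fin n → ℕ → S → ℝ} (hf : FeasNE H P r π w) (k : Fin n) {π' : ℕ → S → A k → ℝ}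
    (hπ' : IsPol H π') {h : ℕ} (hh : h ≤ H) (s : S) :
    val H P (r k) (prodPol (Function.update π k π')) h s ≤ w k h s := by
  obtain ⟨hπ, hw0, hw⟩ := hf
  set τ := Function.update π k π' with hτ
  have hτpol : ∀ j, IsPol H (τ j) := by
    intro j
    rcases eq_or_ne j k with rfl | hj
    · simpa [hτ] using hπ'
    · simpa [hτ, Function.update_of_ne hj] using hπ j
  suffices ∀ t h, h + t = H → ∀ s, valAux P (r k) (prodPol τ) t h s ≤ w k h s from
    this _ _ (by omega) s
  intro t
  induction t with
  | zero =>
    intro h ht s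
    obtain rfl : h = H := by omega
    exact (hw0 k s).ge
  | succ t ih =>
    intro h ht s
    have hlt : h < H := by omega
    calc valAux P (r k) (prodPol τ) (t + 1) h s
        ≤ mixedPayoff (stagePayoff P (r k) h (w k (h + 1)) s) (fun j => τ j h s) := by
          refine sum_le_sum fun a _ => mul_le_mul_of_nonneg_left ?_
            (prod_nonneg fun j _ => (hτpol j h hlt s).1 _)
          exact add_le_add_right (sum_le_sum fun s' _ =>
            mul_le_mul_of_nonneg_left (ih _ (by omega) s') ((hP h hlt s a).1 s')) _
      _ = ∑ b, π' h s b *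
            purePayoff (stagePayoff P (r k) h (w k (h + 1)) s) (fun j => π j h s) k b := by
          rw [mixedPayoff_eq_sum_purePayoff _ _ k]
          refine sum_congr rfl fun b _ => ?_
          rw [purePayoff_congr _ (y := fun j => π j h s)
            (fun j hj => by rw [hτ, Function.update_of_ne hj]), hτ, Function.update_self]
      _ ≤ ∑ b, π' h s b * w k h s :=
          sum_le_sum fun b _ => mul_le_mul_of_nonneg_left (hw k h hlt s b) ((hπ' h hlt s).1 b)
      _ = w k h s := by rw [← sum_mul, (hπ' h hlt s).2, one_mul]

theorem FeasNE.val_le (hP : IsKernel H P) {π : ∀ k, ℕ → S → A k → ℝ}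
    {w : Fin n → ℕ → S → ℝ} (hf : FeasNE H P r π w) (k : Fin n) {h : ℕ} (hh : h ≤ H) (s : S) :
    val H P (r k) (prodPol π) h s ≤ w k h s := by
  simpa using hf.val_update_le hP k (hf.1 k) hh s

/-- Backward-induction values with `t` steps to go, given a selection `e` of stage profiles. -/
noncomputable def inductionValue (H : ℕ) (P : ℕ → S → (∀ k, A k) → S → ℝ)
    (r : Fin n → ℕ → S → (∀ k, A k) → ℝ)
    (e : (Fin n → (∀ k, A k) → ℝ) → ∀ k, A k → ℝ) : ℕ → Fin n → S → ℝ
  | 0, _, _ => 0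
  | t + 1, k, s =>
      mixedPayoff (stagePayoff P (r k) (H - (t + 1)) (inductionValue H P r e t k) s)
        (e fun j => stagePayoff P (r j) (H - (t + 1)) (inductionValue H P r e t j) s)

/-- Every finite-horizon Markov game has a feasible point of `P_NE` at which `w` is the value of the
product policy `π`. -/
theorem exists_feasNE_val_eq [∀ k, Nonempty (A k)] (H : ℕ) (P : ℕ → S → (∀ k, A k) → S → ℝ)
    (r : Fin n → ℕ → S → (∀ k, A k) → ℝ) :
    ∃ (π : ∀ k, ℕ → S → A k → ℝ) (w : Fin n → ℕ → S → ℝ), FeasNE H P r π w ∧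
      ∀ k h, h ≤ H → ∀ s, val H P (r k) (prodPol π) h s = w k h s := by
  choose e hed hen using exists_mixed_nash (n := n) (A := A)
  let w : Fin n → ℕ → S → ℝ := fun k h => inductionValue H P r e (H - h) k
  let π : ∀ k, ℕ → S → A k → ℝ :=
    fun k h s => e (fun j => stagePayoff P (r j) h (w j (h + 1)) s) k
  have hw : ∀ k h, h < H → ∀ s, w k h s =
      mixedPayoff (stagePayoff P (r k) h (w k (h + 1)) s) (fun j => π j h s) := by
    intro k h hh s
    have h1 : H - h = (H - (h + 1)) + 1 := by omega
    have h2 : H - ((H - (h + 1)) + 1) = h := by omega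
    simp only [w, π]
    rw [h1, inductionValue, h2]
  have hwH : ∀ k s, w k H s = 0 := by
    intro k s
    simp [w, inductionValue]
  refine ⟨π, w, ⟨fun k h _ s => hed _ k, hwH, fun k h hh s b => ?_⟩, ?_⟩
  · rw [hw k h hh s]
    exact hen _ k b
  · intro k h hh s
    suffices ∀ t h, h + t = H → ∀ s, valAux P (r k) (prodPol π) t h s = w k h s from
      this _ _ (by omega) s
    intro t
    induction t with
    | zero =>
      intro h ht s
      obtain rfl : h = H := by omega
      exact (hwH k s).symm
    | succ t ih =>
      intro h ht s
      rw [hw k h (by omega) s]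
      simp only [valAux, fun s' => ih (h + 1) (by omega) s']
      rfl

end MarkovGame


theorem PNE_feasible_nonneg_min_zero
    {n : ℕ} {S : Type*} [Fintype S] {A : Fin n → Type*}
    [∀ k, Fintype (A k)] [∀ k, DecidableEq (A k)]
    [∀ k, Nonempty (A k)]
    (H : ℕ) (P : ℕ → S → (∀ k, A k) → S → ℝ)
    (r : Fin n → ℕ → S → (∀ k, A k) → ℝ) (s₁ : S)
    (hP : IsKernel H P) (hr : IsReward H r) (hzs : IsZSPolymatrix H r) :
    (∃ π w, FeasNE H P r π w) ∧
    (∀ π w, FeasNE H P r π w →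
      objNE H P r s₁ π w = ∑ k, w k 0 s₁ ∧ 0 ≤ objNE H P r s₁ π w) ∧
    (∃ π w, FeasNE H P r π w ∧ IsNE H P r s₁ 0 π ∧
      (∀ k : Fin n, ∀ h, h ≤ H → ∀ s,
        IsBRVal H P (r k) (prodPol π) k h s (w k h s)) ∧
      objNE H P r s₁ π w = 0) := by
  obtain ⟨π, w, hf, hval⟩ := exists_feasNE_val_eq H P r
  refine ⟨⟨π, w, hf⟩, fun π w hf => ?_, π, w, hf, ?_, ?_, ?_⟩
  · have hsum : ∑ k, val H P (r k) (prodPol π) 0 s₁ = 0 :=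
      sum_valAux_eq_zero hzs.1 _ _ _ (by omega) s₁
    refine ⟨?_, sum_nonneg fun k _ => sub_nonneg.2 (hf.val_le hP k H.zero_le s₁)⟩
    rw [objNE, sum_sub_distrib, hsum, sub_zero]
  · intro k π' hπ'
    rw [val_deviate_prodPol (hf.1 k) π' _ H.zero_le, hval k 0 H.zero_le]
    exact sub_nonpos.2 (hf.val_update_le hP k hπ' H.zero_le s₁)
  · refine fun k h hh s => ⟨⟨π k, hf.1 k, ?_⟩, ?_⟩
    · rw [val_deviate_prodPol (hf.1 k) _ _ hh, Function.update_eq_self, hval k h hh]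
    · rintro _ ⟨π', hπ', rfl⟩
      rw [val_deviate_prodPol (hf.1 k) π' _ hh]
      exact hf.val_update_le hP k hπ' hh s
  · exact sum_eq_zero fun k _ => sub_eq_zero.2 (hval k 0 H.zero_le s₁).symm
end

section
/- Let Γ be a finite-horizon zero-sum polymatrix switching-control Markov game with n players, let ε ≥ 0, and let σ be an ε-approximate CCE of Γ. Then the marginal product policy π^σ, defined by π^σ_{k,h}(a|s) = Σ_{a_{−k} ∈ A_{−k}} σ_h(a, a_{−k}|s) for all k ∈ [n], h ∈ [H], s ∈ S, is an nε-approximate NE of Γ. -/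
open Finset

section Collapse

variable {n : ℕ} {S : Type*} {A : Fin n → Type*}
  [∀ k, Fintype (A k)]

/-- The expectation of `f` under an independent deviation of player `k` is obtained by
first drawing the whole profile and then resampling its `k`-th coordinate. -/
theorem sum_deviate_mul (k : Fin n) (p : ℕ → S → A k → ℝ)
    (μ : ℕ → S → (∀ j, A j) → ℝ) (h : ℕ) (s : S) (f : (∀ j, A j) → ℝ) :
    ∑ a, deviate k p μ h s a * f a =
      ∑ c, μ h s c * ∑ x, p h s x * f (Function.update c k x) := by
  simp only [deviate, mul_sum, sum_mul]
  rw [← Fintype.sum_prod_type', ← Fintype.sum_prod_type']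
  refine Finset.sum_bij'
    (fun z _ => (Function.update z.1 k z.2, z.1 k))
    (fun z _ => (Function.update z.1 k z.2, z.1 k)) ?_ ?_ ?_ ?_ ?_
  · simp
  · simp
  · simp
  · simp
  · rintro ⟨a, b⟩ -
    simp only [Function.update_idem, Function.update_eq_self]
    ring

theorem deviate_prodPol_self {H : ℕ} {π : ∀ k, ℕ → S → A k → ℝ} (hπ : ∀ k, IsPol H (π k))
    (k : Fin n) {h : ℕ} (hh : h < H) (s : S) :
    deviate k (π k) (prodPol π) h s = prodPol π h s := by
  funext a
  have h1 : ∀ b : A k, prodPol π h s (Function.update a k b) =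
      π k h s b * ∏ j ∈ univ.erase k, π j h s (a j) := by
    intro b
    rw [prodPol, ← mul_prod_erase univ _ (mem_univ k), Function.update_self]
    congr 1
    refine prod_congr rfl fun j hj => ?_
    rw [Function.update_of_ne (ne_of_mem_erase hj)]
  rw [deviate, sum_congr rfl fun b _ => h1 b, ← sum_mul, (hπ k h hh s).2, one_mul, prodPol,
    mul_prod_erase univ (fun j => π j h s (a j)) (mem_univ k)]

/-- Policies with identical one-step expectations have identical values. -/
theorem val_congr [Fintype S] {H : ℕ} {P : ℕ → S → (∀ k, A k) → S → ℝ}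
    {rk : ℕ → S → (∀ k, A k) → ℝ}
    {μ ν : ℕ → S → (∀ k, A k) → ℝ}
    (hstep : ∀ h, h < H → ∀ (s : S) (V : S → ℝ),
      ∑ a, μ h s a * (rk h s a + ∑ s', P h s a s' * V s') =
        ∑ a, ν h s a * (rk h s a + ∑ s', P h s a s' * V s'))
    (h : ℕ) (s : S) : val H P rk μ h s = val H P rk ν h s := by
  have key : ∀ t h, t + h ≤ H → valAux P rk μ t h = valAux P rk ν t h := by
    intro t
    induction t with
    | zero => intros; rfl
    | succ t ih =>
      intro h hh
      funext s
      simp only [valAux]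
      rw [ih (h + 1) (by omega)]
      exact hstep h (by omega) s _
  unfold _root_.val
  by_cases hh : h ≤ H
  · rw [key _ _ (by omega)]
  · rw [Nat.sub_eq_zero_of_le (by omega)]
    rfl

/-- When the rewards sum to zero, so do the values of any joint policy. -/
theorem sum_val_eq_zero [Fintype S] {H : ℕ} (P : ℕ → S → (∀ k, A k) → S → ℝ)
    {r : Fin n → ℕ → S → (∀ k, A k) → ℝ}
    (hr : ∀ h, h < H → ∀ s a, ∑ k, r k h s a = 0)
    (μ : ℕ → S → (∀ k, A k) → ℝ) (s : S) : ∑ k, val H P (r k) μ 0 s = 0 := by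
  have key : ∀ t h, t + h ≤ H → ∀ s, ∑ k, valAux P (r k) μ t h s = 0 := by
    intro t
    induction t with
    | zero => intros; simp [valAux]
    | succ t ih =>
      intro h hh s
      simp only [valAux]
      rw [sum_comm]
      refine sum_eq_zero fun a _ => ?_
      rw [← mul_sum, sum_add_distrib, hr h (by omega), sum_comm]
      simp [← mul_sum, ih (h + 1) (by omega)]
  exact key _ _ (by simp) s

variable [∀ k, DecidableEq (A k)]

/-- The expectation of a function of a single coordinate depends only on the
marginal of that coordinate. -/
theorem sum_mul_eq_of_marginal_eq {μ ν : ℕ → S → (∀ j, A j) → ℝ} {j : Fin n} {h : ℕ} {s : S}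
    (hm : marginal μ j h s = marginal ν j h s) {F : (∀ j, A j) → ℝ}
    (hF : ∀ a a' : ∀ j, A j, a j = a' j → F a = F a') :
    ∑ a, μ h s a * F a = ∑ a, ν h s a * F a := by
  have hfac : Function.FactorsThrough F (fun a : ∀ j, A j => a j) := fun a a' e => hF a a' e
  set φ : A j → ℝ := Function.extend (fun a : ∀ j, A j => a j) F 0
  have hφ : ∀ a, F a = φ (a j) := fun a => (hfac.extend_apply 0 a).symm
  have key : ∀ ρ : ℕ → S → (∀ j, A j) → ℝ,
      ∑ a, ρ h s a * F a = ∑ b, marginal ρ j h s b * φ b := by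
    intro ρ
    simp only [marginal, sum_mul, ite_mul, zero_mul]
    rw [sum_comm]
    simp [hφ]
  rw [key, key, hm]

/-- If two joint policies have the same marginals, then a deviation of player `k` has the
same expectation against either, for functions of `k`'s and one other action. -/
theorem sum_deviate_mul_congr {μ ν : ℕ → S → (∀ j, A j) → ℝ} {k j : Fin n} {h : ℕ} {s : S}
    (p : ℕ → S → A k → ℝ) (hm : marginal μ j h s = marginal ν j h s) {f : (∀ j, A j) → ℝ}
    (hf : ∀ a a' : ∀ j, A j, a k = a' k → a j = a' j → f a = f a') :
    ∑ a, deviate k p μ h s a * f a = ∑ a, deviate k p ν h s a * f a := by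
  rw [sum_deviate_mul, sum_deviate_mul]
  refine sum_mul_eq_of_marginal_eq hm fun a a' e => ?_
  refine sum_congr rfl fun x _ => ?_
  rw [hf (Function.update a k x) (Function.update a' k x) (by simp)]
  by_cases hjk : j = k
  · subst hjk
    simp
  · simp [Function.update_of_ne hjk, e]

theorem isPol_marginal {H : ℕ} {μ : ℕ → S → (∀ j, A j) → ℝ} (hμ : IsPol H μ) (k : Fin n) :
    IsPol H (marginal μ k) := by
  intro h hh s
  obtain ⟨h0, h1⟩ := hμ h hh s
  refine ⟨fun b => sum_nonneg fun a _ => ?_, ?_⟩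
  · split_ifs
    exacts [h0 a, le_rfl]
  · simp only [marginal]
    rw [sum_comm]
    simpa using h1

theorem marginal_prodPol {H : ℕ} {π : ∀ k, ℕ → S → A k → ℝ} (hπ : ∀ k, IsPol H (π k))
    (k : Fin n) {h : ℕ} (hh : h < H) (s : S) :
    marginal (prodPol π) k h s = π k h s := by
  funext b
  set f : ∀ j, A j → ℝ :=
    Function.update (fun j => π j h s) k (fun x => if x = b then π k h s x else 0) with hf
  have hne : ∀ j, j ≠ k → f j = π j h s := fun j hj => by simp [hf, hj]
  have hk : f k = fun x => if x = b then π k h s x else 0 := by simp [hf]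
  have h1 : ∀ a : ∀ j, A j,
      (if a k = b then prodPol π h s a else 0) = ∏ j, f j (a j) := by
    intro a
    rw [prodPol, ← mul_prod_erase univ (fun j => π j h s (a j)) (mem_univ k),
      ← mul_prod_erase univ (fun j => f j (a j)) (mem_univ k), hk,
      prod_congr rfl fun j hj => congrFun (hne j (ne_of_mem_erase hj)) (a j)]
    simp only [ite_mul, zero_mul]
  rw [marginal, sum_congr rfl fun a _ => h1 a, ← Fintype.prod_sum,
    ← mul_prod_erase univ _ (mem_univ k), prod_eq_one, hk]
  · simp
  · intro j hj
    rw [hne j (ne_of_mem_erase hj)]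
    exact (hπ j h hh s).2

/-- In a polymatrix switching-control game, the value of a deviation depends on the joint
policy deviated from only through its marginals. -/
theorem val_deviate_congr [Fintype S] {H : ℕ} {P : ℕ → S → (∀ k, A k) → S → ℝ}
    {r : Fin n → ℕ → S → (∀ k, A k) → ℝ}
    (hzs : IsZSPolymatrix H r) (hsc : SwitchingControl H P)
    {μ ν : ℕ → S → (∀ k, A k) → ℝ}
    (hm : ∀ j h, h < H → ∀ s, marginal μ j h s = marginal ν j h s)
    (k : Fin n) (p : ℕ → S → A k → ℝ) (h : ℕ) (s : S) :
    val H P (r k) (deviate k p μ) h s = val H P (r k) (deviate k p ν) h s := by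
  obtain ⟨-, q, -, hq⟩ := hzs
  refine val_congr (fun h hh s V => ?_) h s
  obtain ⟨i, hi⟩ := hsc s
  simp only [mul_add, sum_add_distrib]
  congr 1
  · simp only [hq k h hh s, mul_sum]
    rw [sum_comm, sum_comm (s := univ)]
    refine sum_congr rfl fun j _ => ?_
    refine sum_deviate_mul_congr (j := j) p (hm j h hh s) fun a a' e e' => ?_
    rw [e, e']
  · refine sum_deviate_mul_congr (j := i) p (hm i h hh s) fun a a' _ e => ?_
    rw [hi h hh a a' e]

end Collapse

theorem cce_collapse_polymatrix_switching
    {n : ℕ} {S : Type*} [Fintype S] {A : Fin n → Type*}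
    [∀ k, Fintype (A k)] [∀ k, DecidableEq (A k)]
    (H : ℕ) (P : ℕ → S → (∀ k, A k) → S → ℝ)
    (r : Fin n → ℕ → S → (∀ k, A k) → ℝ) (s₁ : S) (ε : ℝ)
    (σ : ℕ → S → (∀ k, A k) → ℝ)
    (hP : IsKernel H P) (hr : IsReward H r)
    (hzs : IsZSPolymatrix H r) (hsc : SwitchingControl H P)
    (hε : 0 ≤ ε) (hσ : IsPol H σ) (hCCE : IsCCE H P r s₁ ε σ) :
    IsNE H P r s₁ ((n : ℝ) * ε) (fun k => marginal σ k) := by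
  have hpol := isPol_marginal hσ
  have hdev : ∀ k (p : ℕ → S → A k → ℝ),
      val H P (r k) (deviate k p (prodPol fun k => marginal σ k)) 0 s₁ =
        val H P (r k) (deviate k p σ) 0 s₁ := fun k p =>
    val_deviate_congr hzs hsc (fun j _ hh s => marginal_prodPol hpol j hh s) k p 0 s₁
  have hself : ∀ k, val H P (r k) (prodPol fun k => marginal σ k) 0 s₁ -
      val H P (r k) σ 0 s₁ ≤ ε := fun k => by
    have h1 := hCCE k (marginal σ k) (hpol k)
    rw [← hdev] at h1
    rwa [val_congr fun h hh s V => by rw [deviate_prodPol_self hpol k hh s]] at h1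
  intro k p hp
  have hk := hCCE k p hp
  rw [hdev]
  have hsum := sum_le_sum fun j (_ : j ∈ univ.erase k) => hself j
  have h1 := sum_val_eq_zero P hzs.1 (prodPol fun k => marginal σ k) s₁
  have h2 := sum_val_eq_zero P hzs.1 σ s₁
  rw [← add_sum_erase univ _ (mem_univ k)] at h1 h2
  rw [sum_sub_distrib, sum_const, card_erase_of_mem (mem_univ k), card_univ, Fintype.card_fin,
    nsmul_eq_mul, Nat.cast_pred (Fin.pos k)] at hsum
  linarith
end
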